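/- Let g : ℝ → ℝ be smooth with g(0) = 0 and g'(0) = 0 (so g(z) = O(z²)). Then for z ∈ L²(ℝ) ∩ Ḃ^{3/2}_{2,1}(ℝ) with z_x ∈ Ḃ^{1/2}_{2,1}(ℝ), one has ‖g(z)‖_{Ḃ^{3/2}_{1,1}(ℝ)} ≲ ‖z‖_{L²} ‖z_x‖_{Ḃ^{1/2}_{2,1}}, where the implicit constant may depend on ‖z‖_{L^∞}. -/

import Mathlib

open MeasureTheory Real ENNReal SchwartzMap
open scoped FourierTransform
noncomputable section

/-- A homogeneous Littlewood–Paley partition function on `ℝ`. -/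
structure IsLP (φ : ℝ → ℝ) : Prop where
  smooth : ContDiff ℝ (⊤ : ℕ∞) φ
  supp : ∀ ξ, φ ξ ≠ 0 → 3/4 ≤ |ξ| ∧ |ξ| ≤ 8/3
  sum : ∀ ξ : ℝ, ξ ≠ 0 → HasSum (fun q : ℤ => φ ((2:ℝ)^(-q) * ξ)) 1

/-- Homogeneous Littlewood–Paley block `Δ̇_q f = 𝓕⁻(φ(2^{-q}·) 𝓕f)` on `ℝ`. -/
def blk (φ : ℝ → ℝ) (q : ℤ) (f : ℝ → ℂ) : ℝ → ℂ :=
  𝓕⁻ (fun ξ => (φ ((2:ℝ)^(-q) * ξ) : ℂ) * 𝓕 f ξ)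

/-- `ℓ^r` norm of a sequence indexed by `ℤ`. -/
def lpSeq (r : ℝ≥0∞) (a : ℤ → ℝ) : ℝ≥0∞ := eLpNorm a r Measure.count

/-- Homogeneous Besov norm `‖f‖_{Ḃ^s_{p,r}}` on `ℝ`. -/
def besov (φ : ℝ → ℝ) (s : ℝ) (p r : ℝ≥0∞) (f : ℝ → ℂ) : ℝ≥0∞ :=
  lpSeq r (fun q => (2:ℝ) ^ ((q:ℝ) * s) * (eLpNorm (blk φ q f) p volume).toReal)

theorem IsLP.eLpNorm_le_tsum {φ : ℝ → ℝ} (hφ : IsLP φ) {H : ℝ → ℂ}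
    (hH : AEStronglyMeasurable H volume) :
    eLpNorm H 2 volume ≤ ∑' j : ℤ, eLpNorm (fun ξ => (φ ((2:ℝ)^(-j) * ξ) : ℂ) * H ξ) 2 volume := by
  have hm : ∀ j : ℤ, AEStronglyMeasurable (fun ξ => (φ ((2:ℝ)^(-j) * ξ) : ℂ) * H ξ) volume := by
    intro j
    refine AEStronglyMeasurable.mul ?_ hH
    have := hφ.smooth.continuous
    exact Continuous.aestronglyMeasurable (by fun_prop)
  have hlim : ∀ᵐ ξ : ℝ, Filter.Tendsto
      (fun n : ℕ => (∑ j ∈ Finset.Icc (-(n:ℤ)) n, fun ξ => (φ ((2:ℝ)^(-j) * ξ) : ℂ) * H ξ) ξ)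
      Filter.atTop (nhds (H ξ)) := by
    have h0 : ∀ᵐ ξ : ℝ, ξ ≠ 0 := by simp [ae_iff, measure_singleton]
    filter_upwards [h0] with ξ hξ
    have h1 := (Complex.hasSum_ofReal.mpr (hφ.sum ξ hξ)).mul_right (H ξ)
    simp only [Complex.ofReal_one, one_mul] at h1
    simp only [Finset.sum_apply]
    exact h1.comp Finset.tendsto_Icc_neg
  refine (Lp.eLpNorm_lim_le_liminf_eLpNorm (p := 2)
    (fun n => Finset.aestronglyMeasurable_sum _ fun j _ => hm j) H hlim).trans ?_
  refine Filter.liminf_le_of_le (by isBoundedDefault) fun b hb => ?_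
  obtain ⟨n, hn⟩ := hb.exists
  exact hn.trans ((eLpNorm_sum_le (fun j _ => hm j) (by norm_num)).trans (ENNReal.sum_le_tsum _))

theorem eLpNorm_fourier_schwartz (F : 𝓢(ℝ, ℂ)) :
    eLpNorm (𝓕 (F : ℝ → ℂ)) 2 volume = eLpNorm F 2 volume := by
  have h := SchwartzMap.norm_fourier_toL2_eq F
  rw [SchwartzMap.norm_toLp, SchwartzMap.norm_toLp,
    ENNReal.toReal_eq_toReal_iff' ((𝓕 F).memLp 2 volume).eLpNorm_ne_top
      (F.memLp 2 volume).eLpNorm_ne_top] at h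
  simpa [SchwartzMap.fourier_coe] using h

theorem eLpNorm_fourierInv_schwartz (F : 𝓢(ℝ, ℂ)) :
    eLpNorm (𝓕⁻ (F : ℝ → ℂ)) 2 volume = eLpNorm F 2 volume := by
  have h := eLpNorm_fourier_schwartz (𝓕⁻ F)
  rw [← SchwartzMap.fourier_coe, FourierTransform.fourier_fourierInv_eq] at h
  rw [← SchwartzMap.fourierInv_coe, h]

/-- Frequency-side `L²` size of a Littlewood–Paley block. -/
def freqBlk (φ : ℝ → ℝ) (w : ℝ → ℂ) (j : ℤ) : ℝ≥0∞ :=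
  eLpNorm (fun ξ => (φ ((2:ℝ)^(-j) * ξ) : ℂ) * 𝓕 w ξ) 2 volume

theorem IsLP.hasCompactSupport {φ : ℝ → ℝ} (hφ : IsLP φ) : HasCompactSupport φ := by
  refine HasCompactSupport.of_support_subset_isCompact (isCompact_Icc (a := -(8/3:ℝ)) (b := 8/3)) ?_
  intro ξ hξ
  exact abs_le.mp (hφ.supp ξ hξ).2

theorem IsLP.exists_schwartz {φ : ℝ → ℝ} (hφ : IsLP φ) (w : 𝓢(ℝ, ℂ)) (j : ℤ) :
    ∃ F : 𝓢(ℝ, ℂ), (F : ℝ → ℂ) = fun ξ => (φ ((2:ℝ)^(-j) * ξ) : ℂ) * 𝓕 (w : ℝ → ℂ) ξ := by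
  have h1 : HasCompactSupport (fun ξ => (φ ((2:ℝ)^(-j) * ξ) : ℂ) * 𝓕 (w : ℝ → ℂ) ξ) := by
    apply HasCompactSupport.mul_right
    have h2 := hφ.hasCompactSupport.comp_homeomorph
      (Homeomorph.mulLeft₀ ((2:ℝ)^(-j)) (by positivity))
    exact h2.comp_left (g := ((↑) : ℝ → ℂ)) Complex.ofReal_zero
  have h3 : ContDiff ℝ (⊤ : ℕ∞) (fun ξ => (φ ((2:ℝ)^(-j) * ξ) : ℂ) * 𝓕 (w : ℝ → ℂ) ξ) := by
    have h4 := hφ.smooth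
    have h5 : ContDiff ℝ (⊤ : ℕ∞) (𝓕 (w : ℝ → ℂ)) := by
      rw [← SchwartzMap.fourier_coe]; exact (𝓕 w).smooth _
    exact (Complex.ofRealCLM.contDiff.comp (h4.comp (contDiff_const.mul contDiff_id))).mul h5
  exact ⟨h1.toSchwartzMap h3, rfl⟩

theorem IsLP.eLpNorm_blk {φ : ℝ → ℝ} (hφ : IsLP φ) (w : 𝓢(ℝ, ℂ)) (j : ℤ) :
    eLpNorm (blk φ j w) 2 volume = freqBlk φ w j ∧ freqBlk φ w j ≠ ⊤ := by
  obtain ⟨F, hF⟩ := hφ.exists_schwartz w j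
  unfold blk freqBlk
  rw [← hF]
  exact ⟨eLpNorm_fourierInv_schwartz F, (F.memLp 2 volume).eLpNorm_ne_top⟩

theorem fourier_sub_translate (w : 𝓢(ℝ, ℂ)) (y : ℝ) :
    eLpNorm (fun x => w (x - y) - w x) 2 volume =
      eLpNorm (fun ξ => (Complex.exp (Complex.I * ((-(2 * π * y * ξ) : ℝ) : ℂ)) - 1) *
        𝓕 (w : ℝ → ℂ) ξ) 2 volume := by
  have hD : (fun x => w (x - y) - w x) = ((SchwartzMap.compSubConstCLM ℂ y w - w : 𝓢(ℝ, ℂ)) : ℝ → ℂ) := by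
    ext x; simp
  rw [hD, ← eLpNorm_fourier_schwartz, ← SchwartzMap.fourier_coe, sub_eq_add_neg,
    FourierTransform.fourier_add, FourierTransform.fourier_neg]
  congr 1
  ext ξ
  have h : 𝓕 (fun x => w (x - y)) ξ =
      Complex.exp (Complex.I * ((-(2 * π * y * ξ) : ℝ) : ℂ)) * 𝓕 (w : ℝ → ℂ) ξ := by
    rw [Real.fourier_real_eq_integral_exp_smul, Real.fourier_real_eq_integral_exp_smul,
      ← integral_const_mul, ← integral_add_right_eq_self _ y]
    congr 1
    ext v
    rw [smul_eq_mul, smul_eq_mul, ← mul_assoc, ← Complex.exp_add]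
    rw [add_sub_cancel_right]
    congr 2
    push_cast
    ring
  have h' : (SchwartzMap.compSubConstCLM ℂ y w : ℝ → ℂ) = fun x => w (x - y) := by
    ext x; simp
  rw [add_apply, neg_apply, SchwartzMap.fourier_coe,
    SchwartzMap.fourier_coe, h', h]
  ring

theorem IsLP.eLpNorm_translate_sub_le {φ : ℝ → ℝ} (hφ : IsLP φ) (w : 𝓢(ℝ, ℂ)) (y : ℝ) :
    eLpNorm (fun x => w (x - y) - w x) 2 volume ≤
      ∑' j : ℤ, ENNReal.ofReal (20 * min 1 (|y| * (2:ℝ)^j)) * freqBlk φ w j := by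
  rw [fourier_sub_translate]
  have hw : Continuous (𝓕 (w : ℝ → ℂ)) := by
    rw [← SchwartzMap.fourier_coe]; exact (𝓕 w).continuous
  refine (hφ.eLpNorm_le_tsum (Continuous.aestronglyMeasurable (by fun_prop))).trans ?_
  refine ENNReal.tsum_le_tsum fun j => ?_
  refine eLpNorm_le_mul_eLpNorm_of_ae_le_mul (Filter.Eventually.of_forall fun ξ => ?_) 2
  rw [norm_mul, norm_mul, norm_mul, mul_left_comm]
  by_cases h0 : φ ((2:ℝ)^(-j) * ξ) = 0
  · simp only [h0, Complex.ofReal_zero, norm_zero, zero_mul, mul_zero, le_refl]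
  gcongr
  have h1 := (hφ.supp _ h0).2
  have h2 : |ξ| ≤ 8/3 * (2:ℝ)^j := by
    rw [abs_mul, abs_of_pos (by positivity), zpow_neg, inv_mul_le_iff₀ (by positivity)] at h1
    linarith
  have h3 := Real.norm_exp_I_mul_ofReal_sub_one_le (x := -(2 * π * y * ξ))
  have h4 : ‖Complex.exp (Complex.I * ((-(2 * π * y * ξ) : ℝ) : ℂ)) - 1‖ ≤ 2 := by
    refine (norm_sub_le _ _).trans ?_
    rw [mul_comm Complex.I, Complex.norm_exp_ofReal_mul_I]
    norm_num
  rw [mul_min_of_nonneg _ _ (by norm_num)]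
  refine le_min (h4.trans (by norm_num)) (h3.trans ?_)
  rw [norm_neg, Real.norm_eq_abs, abs_mul, abs_mul, abs_of_pos (by positivity : 0 < 2 * π)]
  have h5 := Real.pi_lt_d2
  have h6 : |y| * |ξ| ≤ |y| * (8/3 * (2:ℝ)^j) := by gcongr
  have h7 : 0 ≤ |y| * (2:ℝ)^j := by positivity
  nlinarith [Real.pi_pos]

theorem fourier_derivCLM (z : 𝓢(ℝ, ℂ)) (ξ : ℝ) :
    𝓕 (SchwartzMap.derivCLM ℂ ℂ z : ℝ → ℂ) ξ = (2 * π * Complex.I * ξ) * 𝓕 (z : ℝ → ℂ) ξ := by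
  have h : (SchwartzMap.derivCLM ℂ ℂ z : ℝ → ℂ) = deriv z := by
    ext x; exact SchwartzMap.derivCLM_apply ..
  have h2 := (SchwartzMap.derivCLM ℂ ℂ z).integrable (μ := volume)
  rw [h] at h2 ⊢
  rw [Real.fourier_deriv z.integrable z.differentiable h2]
  simp

theorem IsLP.zpow_mul_freqBlk_le {φ : ℝ → ℝ} (hφ : IsLP φ) (z : 𝓢(ℝ, ℂ)) (j : ℤ) :
    ENNReal.ofReal ((2:ℝ)^j) * freqBlk φ z j ≤ freqBlk φ (SchwartzMap.derivCLM ℂ ℂ z) j := by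
  have h : freqBlk φ z j ≤ ENNReal.ofReal ((2:ℝ)^(-j)) *
      freqBlk φ (SchwartzMap.derivCLM ℂ ℂ z) j := by
    refine eLpNorm_le_mul_eLpNorm_of_ae_le_mul (Filter.Eventually.of_forall fun ξ => ?_) 2
    simp only [fourier_derivCLM, norm_mul]
    by_cases h0 : φ ((2:ℝ)^(-j) * ξ) = 0
    · simp only [h0, Complex.ofReal_zero, norm_zero, zero_mul, mul_zero, le_refl]
    have h1 := (hφ.supp _ h0).1
    rw [abs_mul, abs_of_pos (by positivity)] at h1
    have h5 := Real.pi_gt_three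
    have h6 : 1 ≤ (2:ℝ)^(-j) * (2 * π * |ξ|) := by nlinarith
    simp only [Complex.norm_I, Complex.norm_real, Real.norm_eq_abs, abs_of_pos Real.pi_pos,
      mul_one, Complex.norm_ofNat]
    have := mul_le_mul_of_nonneg_right h6
      (by positivity : 0 ≤ |φ ((2:ℝ)^(-j) * ξ)| * ‖𝓕 (z : ℝ → ℂ) ξ‖)
    linarith
  calc _ ≤ ENNReal.ofReal ((2:ℝ)^j) * (ENNReal.ofReal ((2:ℝ)^(-j)) *
      freqBlk φ (SchwartzMap.derivCLM ℂ ℂ z) j) := by gcongr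
    _ = _ := by
      rw [← mul_assoc, ← ENNReal.ofReal_mul (by positivity), ← zpow_add₀ two_ne_zero]
      simp

theorem IsLP.exists_freqBlk_le {φ : ℝ → ℝ} (hφ : IsLP φ) :
    ∃ P > (0:ℝ), ∀ (z : 𝓢(ℝ, ℂ)) (j : ℤ),
      freqBlk φ z j ≤ ENNReal.ofReal P * eLpNorm z 2 volume ∧
      freqBlk φ (SchwartzMap.derivCLM ℂ ℂ z) j ≤
        ENNReal.ofReal P * ENNReal.ofReal ((2:ℝ)^j) * eLpNorm z 2 volume := by
  obtain ⟨P, hP⟩ := hφ.hasCompactSupport.exists_bound_of_continuous hφ.smooth.continuous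
  have hP0 : 0 ≤ P := (norm_nonneg _).trans (hP 0)
  refine ⟨20 * (P + 1), by positivity, fun z j => ⟨?_, ?_⟩⟩
  · rw [← eLpNorm_fourier_schwartz]
    refine eLpNorm_le_mul_eLpNorm_of_ae_le_mul (Filter.Eventually.of_forall fun ξ => ?_) 2
    rw [norm_mul, Complex.norm_real]
    gcongr
    linarith [hP ((2:ℝ)^(-j) * ξ)]
  · rw [← eLpNorm_fourier_schwartz, ← ENNReal.ofReal_mul (by positivity)]
    refine eLpNorm_le_mul_eLpNorm_of_ae_le_mul (Filter.Eventually.of_forall fun ξ => ?_) 2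
    simp only [fourier_derivCLM, norm_mul]
    by_cases h0 : φ ((2:ℝ)^(-j) * ξ) = 0
    · simp only [h0, Complex.ofReal_zero, norm_zero, zero_mul]; positivity
    have h1 := (hφ.supp _ h0).2
    have h2 : |ξ| ≤ 8/3 * (2:ℝ)^j := by
      rw [abs_mul, abs_of_pos (by positivity), zpow_neg, inv_mul_le_iff₀ (by positivity)] at h1
      linarith
    simp only [Complex.norm_I, Complex.norm_real, Real.norm_eq_abs, abs_of_pos Real.pi_pos,
      mul_one, Complex.norm_ofNat]
    rw [← mul_assoc]
    refine mul_le_mul_of_nonneg_right ?_ (norm_nonneg _)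
    have h5 := Real.pi_lt_d2
    have h6 : 2 * π * |ξ| ≤ 20 * (2:ℝ)^j := by
      have : 0 < (2:ℝ)^j := by positivity
      nlinarith [Real.pi_pos, abs_nonneg ξ]
    calc |φ ((2:ℝ)^(-j) * ξ)| * (2 * π * |ξ|) ≤ (P + 1) * (20 * (2:ℝ)^j) := by
          gcongr
          linarith [hP ((2:ℝ)^(-j) * ξ), Real.norm_eq_abs (φ ((2:ℝ)^(-j) * ξ))]
      _ = _ := by ring

theorem integral_fourier_mul_eq_of_integrable {F G : ℝ → ℂ} (hF : Integrable F)
    (hG : Integrable G) : ∫ ξ, 𝓕 F ξ * G ξ = ∫ t, F t * 𝓕 G t := by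
  have h := VectorFourier.integral_fourierIntegral_smul_eq_flip (L := innerₗ ℝ)
      Real.continuous_fourierChar continuous_inner hF hG
  rw [flip_innerₗ] at h
  exact h

theorem IsLP.exists_symbol {φ : ℝ → ℝ} (hφ : IsLP φ) :
    ∃ m : 𝓢(ℝ, ℂ), m 0 = 0 ∧ ∀ ξ : ℝ, m ξ * (2 * π * Complex.I * ξ) = φ ξ := by
  have hz : ∀ ξ : ℝ, |ξ| < 3/4 → φ ξ = 0 := fun ξ h => by
    by_contra h0
    linarith [(hφ.supp ξ h0).1]
  have h1 : HasCompactSupport (fun ξ : ℝ => (φ ξ : ℂ) * (2 * π * Complex.I * ξ)⁻¹) :=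
    HasCompactSupport.mul_right
      (hφ.hasCompactSupport.comp_left (g := ((↑) : ℝ → ℂ)) Complex.ofReal_zero)
  have h2 : ContDiff ℝ (⊤ : ℕ∞) (fun ξ : ℝ => (φ ξ : ℂ) * (2 * π * Complex.I * ξ)⁻¹) := by
    rw [contDiff_iff_contDiffAt]
    intro ξ
    by_cases h : |ξ| < 3/4
    · have : (fun ξ : ℝ => (φ ξ : ℂ) * (2 * π * Complex.I * ξ)⁻¹) =ᶠ[nhds ξ] fun _ => 0 := by
        filter_upwards [(isOpen_lt continuous_abs continuous_const).mem_nhds h] with t ht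
        simp [hz t ht]
      exact contDiffAt_const.congr_of_eventuallyEq this
    · have h0 : ξ ≠ 0 := by rintro rfl; norm_num at h
      refine (Complex.ofRealCLM.contDiff.comp hφ.smooth).contDiffAt.mul (ContDiffAt.inv ?_ ?_)
      · exact contDiffAt_const.mul Complex.ofRealCLM.contDiff.contDiffAt
      · simp [Real.pi_ne_zero, h0]
  refine ⟨h1.toSchwartzMap h2, by simp, fun ξ => ?_⟩
  simp only [HasCompactSupport.toSchwartzMap_toFun]
  by_cases h0 : ξ = 0
  · simp [h0, hz 0 (by norm_num)]
  · rw [inv_mul_cancel_right₀]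
    simp [Real.pi_ne_zero, h0]

theorem integral_fourierInv_schwartz (m : 𝓢(ℝ, ℂ)) : ∫ y, (𝓕⁻ m) y = m 0 := by
  have h : 𝓕 ((𝓕⁻ m : 𝓢(ℝ, ℂ)) : ℝ → ℂ) 0 = m 0 := by
    rw [← SchwartzMap.fourier_coe, FourierTransform.fourier_fourierInv_eq]
  rw [← h, Real.fourier_real_eq]
  simp

theorem blk_eq_integral {φ : ℝ → ℝ} {m : 𝓢(ℝ, ℂ)} (hm0 : m 0 = 0)
    (hm : ∀ ξ : ℝ, m ξ * (2 * π * Complex.I * ξ) = φ ξ) {f : ℝ → ℂ} (hf : Integrable f)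
    (hfd : Differentiable ℝ f) (hf' : Integrable (deriv f)) (q : ℤ) (x : ℝ) :
    blk φ q f x = ∫ y, (𝓕⁻ m) ((2:ℝ)^q * y) * (deriv f (x - y) - deriv f x) := by
  have h2 : (0:ℝ) < (2:ℝ)^q := by positivity
  set G : ℝ → ℂ := fun ξ => Complex.exp ((2 * π * (ξ * x) : ℝ) * Complex.I) *
    ((((2:ℝ)^(-q) : ℝ) : ℂ) * m ((2:ℝ)^(-q) * ξ)) with hG
  have hmint : Integrable (fun ξ => m ((2:ℝ)^(-q) * ξ)) :=
    m.integrable.comp_mul_left' (by positivity)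
  have hGint : Integrable G := by
    refine (hmint.const_mul _).bdd_mul (c := 1) (Continuous.aestronglyMeasurable (by fun_prop)) ?_
    exact Filter.Eventually.of_forall fun ξ => (Complex.norm_exp_ofReal_mul_I _).le
  have hFG : ∀ t, 𝓕 G t = (𝓕⁻ m) ((2:ℝ)^q * (x - t)) := by
    intro t
    rw [Real.fourier_real_eq_integral_exp_smul, SchwartzMap.fourierInv_coe,
      Real.fourierInv_eq_fourier_neg, Real.fourier_real_eq_integral_exp_smul]
    have := Measure.integral_comp_mul_left (fun v => Complex.exp
      (((-2 * π * v * (-((2:ℝ)^q * (x - t))) : ℝ) : ℂ) * Complex.I) • m v) ((2:ℝ)^(-q))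
    rw [abs_of_pos (by positivity), inv_eq_iff_eq_inv.mpr (by rw [zpow_neg]) ] at this
    rw [← inv_smul_eq_iff₀ h2.ne'] at this
    rw [← this, ← integral_smul]
    congr 1
    ext v
    rw [hG]
    simp only [smul_eq_mul, ← zpow_neg, Complex.real_smul]
    have he : Complex.exp (((-2 * π * ((2:ℝ)^(-q) * v) * (-((2:ℝ)^q * (x - t))) : ℝ) : ℂ) *
        Complex.I) = Complex.exp (((-2 * π * v * t : ℝ) : ℂ) * Complex.I) *
        Complex.exp (((2 * π * (v * x) : ℝ) : ℂ) * Complex.I) := by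
      rw [← Complex.exp_add, ← add_mul, ← Complex.ofReal_add]
      congr 3
      rw [zpow_neg]
      field_simp
      ring
    rw [he]
    ring
  have hblk : blk φ q f x = ∫ ξ, 𝓕 (deriv f) ξ * G ξ := by
    rw [blk, Real.fourierInv_eq', Real.fourier_deriv hf hfd hf']
    congr 1
    ext ξ
    rw [← hm, hG]
    simp only [smul_eq_mul, RCLike.inner_apply, conj_trivial]
    push_cast
    rw [mul_comm (x : ℂ)]
    ring
  have hK : Integrable (fun y => (𝓕⁻ m) ((2:ℝ)^q * y)) :=
    (𝓕⁻ m).integrable.comp_mul_left' (by positivity)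
  have hK0 : ∫ y, (𝓕⁻ m) ((2:ℝ)^q * y) = 0 := by
    refine (Measure.integral_comp_mul_left (fun y => (𝓕⁻ m) y) ((2:ℝ)^q)).trans ?_
    rw [integral_fourierInv_schwartz, hm0, smul_zero]
  rw [hblk, integral_fourier_mul_eq_of_integrable hf' hGint]
  simp only [hFG]
  rw [← integral_sub_left_eq_self _ volume x]
  simp only [_root_.sub_sub_cancel, mul_sub]
  obtain ⟨B, hB⟩ : ∃ B, ∀ y, ‖(𝓕⁻ m) ((2:ℝ)^q * y)‖ ≤ B :=
    ⟨_, fun y => SchwartzMap.norm_le_seminorm ℝ (𝓕⁻ m) _⟩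
  rw [integral_sub, integral_mul_const, hK0, zero_mul, sub_zero]
  · simp only [mul_comm]
  · refine (hf'.comp_sub_left x).bdd_mul (c := B) hK.aestronglyMeasurable ?_
    exact Filter.Eventually.of_forall hB
  · exact hK.mul_const _

theorem eLpNorm_blk_one_le {φ : ℝ → ℝ} {m : 𝓢(ℝ, ℂ)} (hm0 : m 0 = 0)
    (hm : ∀ ξ : ℝ, m ξ * (2 * π * Complex.I * ξ) = φ ξ) {f : ℝ → ℂ} (hf : Integrable f)
    (hfd : ContDiff ℝ 1 f) (hf' : Integrable (deriv f)) (q : ℤ) :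
    eLpNorm (blk φ q f) 1 volume ≤ ∫⁻ y, ‖(𝓕⁻ m) ((2:ℝ)^q * y)‖ₑ *
      eLpNorm (fun x => deriv f (x - y) - deriv f x) 1 volume := by
  have hc : Continuous (deriv f) := hfd.continuous_deriv le_rfl
  have hk : Continuous ((𝓕⁻ m : 𝓢(ℝ, ℂ)) : ℝ → ℂ) := (𝓕⁻ m).continuous
  simp only [eLpNorm_one_eq_lintegral_enorm]
  calc ∫⁻ x, ‖blk φ q f x‖ₑ
      ≤ ∫⁻ x, ∫⁻ y, ‖(𝓕⁻ m) ((2:ℝ)^q * y)‖ₑ * ‖deriv f (x - y) - deriv f x‖ₑ := by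
        refine lintegral_mono fun x => ?_
        rw [blk_eq_integral hm0 hm hf (hfd.differentiable one_ne_zero) hf']
        refine (enorm_integral_le_lintegral_enorm _).trans_eq ?_
        simp only [enorm_mul]
    _ = ∫⁻ y, ∫⁻ x, ‖(𝓕⁻ m) ((2:ℝ)^q * y)‖ₑ * ‖deriv f (x - y) - deriv f x‖ₑ := by
        refine lintegral_lintegral_swap ?_
        change AEMeasurable (fun p : ℝ × ℝ =>
          ‖(𝓕⁻ m) ((2:ℝ)^q * p.2)‖ₑ * ‖deriv f (p.1 - p.2) - deriv f p.1‖ₑ) _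
        have h1 : Continuous fun p : ℝ × ℝ => ‖(𝓕⁻ m) ((2:ℝ)^q * p.2)‖ₑ := by fun_prop
        have h2 : Continuous fun p : ℝ × ℝ => ‖deriv f (p.1 - p.2) - deriv f p.1‖ₑ := by fun_prop
        exact (h1.measurable.mul h2.measurable).aemeasurable
    _ = _ := by
        refine lintegral_congr fun y => ?_
        rw [lintegral_const_mul]
        fun_prop

theorem exists_lipschitz_bound {g : ℝ → ℝ} (hg : ContDiff ℝ (⊤ : ℕ∞) g) (hg0 : g 0 = 0)
    (hg0' : deriv g 0 = 0) {M : ℝ} (hM : 0 < M) :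
    ∃ L ≥ (0:ℝ), (∀ u v, |u| ≤ M → |v| ≤ M → |deriv g u - deriv g v| ≤ L * |u - v|) ∧
      (∀ u, |u| ≤ M → |deriv g u| ≤ L * |u|) ∧ ∀ u, |u| ≤ M → |g u| ≤ L * M * |u| := by
  have h1 : ContDiff ℝ (⊤ : ℕ∞) (deriv g) := (contDiff_infty_iff_deriv.mp hg).2
  have h2 : ContDiff ℝ (⊤ : ℕ∞) (deriv (deriv g)) := (contDiff_infty_iff_deriv.mp h1).2
  obtain ⟨L, hL⟩ := (isCompact_Icc (a := -M) (b := M)).exists_bound_of_continuousOn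
    h2.continuous.continuousOn
  have hL0 : 0 ≤ L := (norm_nonneg _).trans (hL 0 ⟨by linarith, hM.le⟩)
  have hlip : ∀ u v, |u| ≤ M → |v| ≤ M → |deriv g u - deriv g v| ≤ L * |u - v| := by
    intro u v hu hv
    exact (convex_Icc (-M) M).norm_image_sub_le_of_norm_deriv_le
      (fun x _ => h1.differentiable (by simp) x) hL (abs_le.mp hv) (abs_le.mp hu)
  have hzero : |(0:ℝ)| ≤ M := by simpa using hM.le
  have hlin : ∀ u, |u| ≤ M → |deriv g u| ≤ L * |u| := by
    intro u hu
    simpa [hg0'] using hlip u 0 hu hzero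
  refine ⟨L, hL0, hlip, hlin, fun u hu => ?_⟩
  have := (convex_Icc (-M) M).norm_image_sub_le_of_norm_deriv_le (f := g) (C := L * M)
      (fun x _ => hg.differentiable (by simp) x)
      (fun x hx => (hlin x (abs_le.mpr hx)).trans (by gcongr; exact abs_le.mpr hx))
      (abs_le.mp hzero) (abs_le.mp hu)
  simpa [hg0] using this

theorem lintegral_enorm_mul_le {a b : ℝ → ℂ} (ha : Continuous a) (hb : Continuous b) :
    ∫⁻ x, ‖a x‖ₑ * ‖b x‖ₑ ≤ eLpNorm a 2 volume * eLpNorm b 2 volume := by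
  have h := eLpNorm_smul_le_mul_eLpNorm (p := 2) (q := 2) (r := 1) (μ := volume)
    hb.aestronglyMeasurable ha.aestronglyMeasurable
  simpa [eLpNorm_one_eq_lintegral_enorm] using h

/-- The complexification of a real Schwartz function. -/
def complexify (z : 𝓢(ℝ, ℝ)) : 𝓢(ℝ, ℂ) := z.postcompCLM Complex.ofRealCLM

theorem complexify_apply (z : 𝓢(ℝ, ℝ)) (x : ℝ) : complexify z x = (z x : ℂ) := rfl

theorem derivCLM_complexify_apply (z : 𝓢(ℝ, ℝ)) (x : ℝ) :
    SchwartzMap.derivCLM ℂ ℂ (complexify z) x = ((deriv z x : ℝ) : ℂ) := by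
  rw [SchwartzMap.derivCLM_apply]
  exact (z.differentiableAt.hasDerivAt.ofReal_comp (z := x)).deriv

theorem hasDerivAt_comp_schwartz {g : ℝ → ℝ} (hg : ContDiff ℝ (⊤ : ℕ∞) g) (z : 𝓢(ℝ, ℝ)) (x : ℝ) :
    HasDerivAt (fun x => ((g (z x) : ℝ) : ℂ)) ((deriv g (z x) * deriv z x : ℝ) : ℂ) x :=
  (((hg.differentiable (by simp)) (z x)).hasDerivAt.comp x
    (z.differentiableAt (x := x)).hasDerivAt).ofReal_comp

theorem eLpNorm_deriv_comp_translate_le {g : ℝ → ℝ} (hg : ContDiff ℝ (⊤ : ℕ∞) g) {L M : ℝ}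
    (hL : 0 ≤ L)
    (hlip : ∀ u v, |u| ≤ M → |v| ≤ M → |deriv g u - deriv g v| ≤ L * |u - v|)
    (hlin : ∀ u, |u| ≤ M → |deriv g u| ≤ L * |u|) (z : 𝓢(ℝ, ℝ)) (hz : ∀ x, |z x| ≤ M) (y : ℝ) :
    eLpNorm (fun x => deriv (fun x => ((g (z x) : ℝ) : ℂ)) (x - y) -
        deriv (fun x => ((g (z x) : ℝ) : ℂ)) x) 1 volume ≤
      ENNReal.ofReal L * (eLpNorm (complexify z) 2 volume *
        eLpNorm (fun x => SchwartzMap.derivCLM ℂ ℂ (complexify z) (x - y) -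
          SchwartzMap.derivCLM ℂ ℂ (complexify z) x) 2 volume +
        eLpNorm (fun x => complexify z (x - y) - complexify z x) 2 volume *
        eLpNorm (SchwartzMap.derivCLM ℂ ℂ (complexify z)) 2 volume) := by
  set Z := complexify z with hZ
  set W := SchwartzMap.derivCLM ℂ ℂ Z with hW
  have hZc := Z.continuous
  have hWc := W.continuous
  have hpt : ∀ x, ‖deriv (fun x => ((g (z x) : ℝ) : ℂ)) (x - y) -
      deriv (fun x => ((g (z x) : ℝ) : ℂ)) x‖ₑ ≤ ENNReal.ofReal L *
      (‖Z (x - y)‖ₑ * ‖W (x - y) - W x‖ₑ + ‖Z (x - y) - Z x‖ₑ * ‖W x‖ₑ) := by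
    intro x
    simp only [← ofReal_norm]
    rw [← ENNReal.ofReal_mul (norm_nonneg _), ← ENNReal.ofReal_mul (norm_nonneg _),
      ← ENNReal.ofReal_add (by positivity) (by positivity), ← ENNReal.ofReal_mul hL]
    refine ENNReal.ofReal_le_ofReal ?_
    rw [(hasDerivAt_comp_schwartz hg z _).deriv, (hasDerivAt_comp_schwartz hg z _).deriv]
    simp only [hW, hZ, derivCLM_complexify_apply, complexify_apply, ← Complex.ofReal_sub,
      Complex.norm_real, Real.norm_eq_abs]
    have e : deriv g (z (x - y)) * deriv z (x - y) - deriv g (z x) * deriv z x =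
      deriv g (z (x - y)) * (deriv z (x - y) - deriv z x) +
        (deriv g (z (x - y)) - deriv g (z x)) * deriv z x := by ring
    rw [e]
    refine (abs_add_le _ _).trans ?_
    rw [abs_mul, abs_mul, mul_add, ← mul_assoc, ← mul_assoc]
    gcongr
    · exact hlin _ (hz _)
    · exact hlip _ _ (hz _) (hz _)
  have htr : eLpNorm (fun x => Z (x - y)) 2 volume = eLpNorm Z 2 volume :=
    eLpNorm_comp_measurePreserving Z.continuous.aestronglyMeasurable
      (measurePreserving_sub_right volume y)
  rw [eLpNorm_one_eq_lintegral_enorm]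
  refine (lintegral_mono hpt).trans ?_
  rw [lintegral_const_mul _ (by fun_prop), lintegral_add_left (by fun_prop), ← htr]
  gcongr
  · exact lintegral_enorm_mul_le (by fun_prop) (by fun_prop)
  · exact lintegral_enorm_mul_le (by fun_prop) (by fun_prop)

theorem integrable_comp_schwartz {g : ℝ → ℝ} (hg : ContDiff ℝ (⊤ : ℕ∞) g) {K M : ℝ}
    (hlin : ∀ u, |u| ≤ M → |g u| ≤ K * |u|) (z : 𝓢(ℝ, ℝ)) (hz : ∀ x, |z x| ≤ M) :
    Integrable (fun x => ((g (z x) : ℝ) : ℂ)) := by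
  have hc := hg.continuous
  have hzc := z.continuous
  refine (z.integrable.norm.const_mul K).mono' (Continuous.aestronglyMeasurable (by fun_prop)) ?_
  exact Filter.Eventually.of_forall fun x => by simpa using hlin _ (hz x)

theorem integrable_deriv_comp_schwartz {g : ℝ → ℝ} (hg : ContDiff ℝ (⊤ : ℕ∞) g) {L M : ℝ}
    (hL : 0 ≤ L)
    (hlin : ∀ u, |u| ≤ M → |deriv g u| ≤ L * |u|) (z : 𝓢(ℝ, ℝ)) (hz : ∀ x, |z x| ≤ M) :
    Integrable (deriv fun x => ((g (z x) : ℝ) : ℂ)) := by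
  have hd : ∀ x, deriv (fun x => ((g (z x) : ℝ) : ℂ)) x =
      ((deriv g (z x) : ℝ) : ℂ) * SchwartzMap.derivCLM ℂ ℂ (complexify z) x := by
    intro x
    rw [(hasDerivAt_comp_schwartz hg z _).deriv, derivCLM_complexify_apply, Complex.ofReal_mul]
  rw [funext hd]
  have hc : Continuous (deriv g) := hg.continuous_deriv (by simp)
  have hzc := z.continuous
  refine (SchwartzMap.integrable _).bdd_mul (c := L * M)
    (Continuous.aestronglyMeasurable (by fun_prop)) ?_
  refine Filter.Eventually.of_forall fun x => ?_
  rw [Complex.norm_real]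
  exact (hlin _ (hz x)).trans (by gcongr; exact hz x)

theorem contDiff_comp_schwartz {g : ℝ → ℝ} (hg : ContDiff ℝ (⊤ : ℕ∞) g) (z : 𝓢(ℝ, ℝ)) :
    ContDiff ℝ 1 (fun x => ((g (z x) : ℝ) : ℂ)) :=
  (Complex.ofRealCLM.contDiff.comp (hg.comp (z.smooth (⊤ : ℕ∞)))).of_le (by simp)

theorem abs_le_of_eLpNorm_top_le (z : 𝓢(ℝ, ℝ)) {M : ℝ} (hM : 0 < M)
    (h : eLpNorm z ∞ (volume : Measure ℝ) ≤ ENNReal.ofReal M) (x : ℝ) : |z x| ≤ M := by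
  have h1 : ∀ᵐ x, ‖z x‖ₑ ≤ ENNReal.ofReal M := by
    filter_upwards [enorm_ae_le_eLpNormEssSup z volume] with x hx
    exact hx.trans (by rwa [← eLpNorm_exponent_top])
  have h2 : ∀ᵐ x, |z x| ≤ M := by
    filter_upwards [h1] with x hx
    rw [← ofReal_norm] at hx
    exact (ENNReal.ofReal_le_ofReal_iff hM.le).mp hx
  have h3 : Dense {x | |z x| ≤ M} := Measure.dense_of_ae h2
  have h4 : IsClosed {x | |z x| ≤ M} := isClosed_le z.continuous.abs continuous_const
  have := h3.closure_eq
  rw [h4.closure_eq] at this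
  exact Set.eq_univ_iff_forall.mp this x

/-- The two-sided geometric weight `2^{-|k|/2}`. -/
def geomWeight (k : ℤ) : ℝ := (2:ℝ) ^ (-|(k:ℝ)| / 2)

theorem geomWeight_pos (k : ℤ) : 0 < geomWeight k := by unfold geomWeight; positivity

theorem summable_geomWeight : Summable geomWeight := by
  have h : Summable fun n : ℕ => ((2:ℝ) ^ (-(1:ℝ) / 2)) ^ n :=
    summable_geometric_of_lt_one (by positivity)
      (Real.rpow_lt_one_of_one_lt_of_neg (by norm_num) (by norm_num))
  have h' : ∀ n : ℕ, ((2:ℝ) ^ (-(1:ℝ) / 2)) ^ n = (2:ℝ) ^ (-(n:ℝ) / 2) := by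
    intro n
    rw [← Real.rpow_natCast, ← Real.rpow_mul (by norm_num)]
    congr 1
    ring
  simp only [h'] at h
  refine Summable.of_nat_of_neg ?_ ?_
  · simpa [geomWeight] using h
  · simpa [geomWeight] using h

theorem tsum_ofReal_geomWeight_sub_right (j : ℤ) :
    ∑' k : ℤ, ENNReal.ofReal (geomWeight (k - j)) = ENNReal.ofReal (∑' k, geomWeight k) := by
  rw [ENNReal.ofReal_tsum_of_nonneg (fun k => (geomWeight_pos k).le) summable_geomWeight]
  exact (Equiv.subRight j).tsum_eq fun k => ENNReal.ofReal (geomWeight k)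

theorem tsum_ofReal_geomWeight_sub_left (k : ℤ) :
    ∑' j : ℤ, ENNReal.ofReal (geomWeight (k - j)) = ENNReal.ofReal (∑' k, geomWeight k) := by
  rw [ENNReal.ofReal_tsum_of_nonneg (fun k => (geomWeight_pos k).le) summable_geomWeight]
  exact (Equiv.subLeft k).tsum_eq fun k => ENNReal.ofReal (geomWeight k)

theorem exists_lintegral_dilate_mul_min_le (l : 𝓢(ℝ, ℂ)) :
    ∃ Cl ≥ (0:ℝ), ∀ q j : ℤ,
      ∫⁻ y : ℝ, ‖l ((2:ℝ)^q * y)‖ₑ * ENNReal.ofReal (min 1 (|y| * (2:ℝ)^j)) ≤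
        ENNReal.ofReal (min 1 ((2:ℝ)^(j - q)) * ((2:ℝ)^(-q) * Cl)) := by
  set h : ℝ → ℝ := fun u => ‖l u‖ * (1 + |u|) with hh
  have hh_int : Integrable h := by
    have h1 := (l.integrable_pow_mul volume 1).add l.integrable.norm
    refine h1.congr (Filter.Eventually.of_forall fun u => ?_)
    simp only [hh, Pi.add_apply, Real.norm_eq_abs]
    ring
  have hnn : ∀ u, 0 ≤ h u := fun u => by positivity
  refine ⟨∫ u, h u, integral_nonneg hnn, fun q j => ?_⟩
  have hq : (0:ℝ) < (2:ℝ)^q := by positivity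
  have hscale : ∫ y, h ((2:ℝ)^q * y) = (2:ℝ)^(-q) * ∫ u, h u := by
    rw [Measure.integral_comp_mul_left h, abs_of_pos (by positivity), zpow_neg, smul_eq_mul]
  rw [← hscale, ENNReal.ofReal_mul (by positivity), ofReal_integral_eq_lintegral_ofReal
    (hh_int.comp_mul_left' hq.ne') (Filter.Eventually.of_forall fun u => hnn _),
    ← lintegral_const_mul' _ _ ENNReal.ofReal_ne_top]
  refine lintegral_mono fun y => ?_
  rw [← ofReal_norm, ← ENNReal.ofReal_mul (norm_nonneg _),
    ← ENNReal.ofReal_mul (by positivity)]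
  refine ENNReal.ofReal_le_ofReal ?_
  rw [hh, mul_left_comm]
  refine mul_le_mul_of_nonneg_left ?_ (norm_nonneg _)
  have e : |y| * (2:ℝ)^j = |(2:ℝ)^q * y| * (2:ℝ)^(j - q) := by
    rw [abs_mul, abs_of_pos hq, zpow_sub₀ two_ne_zero]
    field_simp
  rw [e]
  have hs : (0:ℝ) < (2:ℝ)^(j - q) := by positivity
  have hu := abs_nonneg ((2:ℝ)^q * y)
  rcases le_total ((2:ℝ)^(j - q)) 1 with h1 | h1
  · rw [min_eq_right h1]
    exact (min_le_right _ _).trans (by nlinarith)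
  · rw [min_eq_left h1]
    exact (min_le_left _ _).trans (by linarith)

theorem rpow_mul_min_le (q j : ℤ) :
    (2:ℝ) ^ ((q:ℝ) * (3/2)) * (min 1 ((2:ℝ)^(j - q)) * (2:ℝ)^(-q)) ≤
      (2:ℝ) ^ ((j:ℝ) * (1/2)) * geomWeight (q - j) := by
  rw [geomWeight, ← Real.rpow_add two_pos]
  rcases le_total q j with h | h
  · have h' : (q:ℝ) ≤ j := by exact_mod_cast h
    calc _ ≤ (2:ℝ) ^ ((q:ℝ) * (3/2)) * (1 * (2:ℝ)^(-q)) := by gcongr; exact min_le_left _ _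
      _ = _ := by
        rw [one_mul, ← Real.rpow_intCast, ← Real.rpow_add two_pos]
        congr 1
        push_cast
        rw [abs_of_nonpos (by linarith)]
        ring
  · have h' : (j:ℝ) ≤ q := by exact_mod_cast h
    calc _ ≤ (2:ℝ) ^ ((q:ℝ) * (3/2)) * ((2:ℝ)^(j - q) * (2:ℝ)^(-q)) := by
          gcongr; exact min_le_right _ _
      _ = _ := by
        rw [← Real.rpow_intCast, ← Real.rpow_intCast, ← Real.rpow_add two_pos,
          ← Real.rpow_add two_pos]
        congr 1
        push_cast
        rw [abs_of_nonneg (by linarith)]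
        ring

theorem tsum_lintegral_dilate_le {l : 𝓢(ℝ, ℂ)} {Cl : ℝ} (hCl : 0 ≤ Cl)
    (h : ∀ q j : ℤ,
      ∫⁻ y : ℝ, ‖l ((2:ℝ)^q * y)‖ₑ * ENNReal.ofReal (min 1 (|y| * (2:ℝ)^j)) ≤
        ENNReal.ofReal (min 1 ((2:ℝ)^(j - q)) * ((2:ℝ)^(-q) * Cl))) (j : ℤ) :
    ∑' q : ℤ, ENNReal.ofReal ((2:ℝ) ^ ((q:ℝ) * (3/2))) *
      ∫⁻ y : ℝ, ‖l ((2:ℝ)^q * y)‖ₑ * ENNReal.ofReal (min 1 (|y| * (2:ℝ)^j)) ≤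
    ENNReal.ofReal (Cl * ∑' k, geomWeight k) * ENNReal.ofReal ((2:ℝ) ^ ((j:ℝ) * (1/2))) := by
  rw [ENNReal.ofReal_mul hCl, ← tsum_ofReal_geomWeight_sub_right j, mul_right_comm,
    ← ENNReal.tsum_mul_left]
  refine ENNReal.tsum_le_tsum fun q => ?_
  calc _ ≤ ENNReal.ofReal ((2:ℝ) ^ ((q:ℝ) * (3/2))) *
        ENNReal.ofReal (min 1 ((2:ℝ)^(j - q)) * ((2:ℝ)^(-q) * Cl)) := by gcongr; exact h q j
    _ ≤ _ := by
      rw [← ENNReal.ofReal_mul (by positivity), ← ENNReal.ofReal_mul hCl,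
        ← ENNReal.ofReal_mul (by positivity)]
      refine ENNReal.ofReal_le_ofReal ?_
      have := mul_le_mul_of_nonneg_left (rpow_mul_min_le q j) hCl
      linarith

theorem tsum_mul_tsum_le {A B : ℤ → ℝ≥0∞} {E : ℝ≥0∞} {P : ℝ} (hP : 0 < P)
    (hA : ∀ j, A j ≤ ENNReal.ofReal P * E)
    (hB : ∀ j : ℤ, B j ≤ ENNReal.ofReal P * ENNReal.ofReal ((2:ℝ)^j) * E)
    (hAB : ∀ j : ℤ, ENNReal.ofReal ((2:ℝ)^j) * A j ≤ B j) :
    (∑' j : ℤ, ENNReal.ofReal ((2:ℝ) ^ ((j:ℝ) * (1/2))) * A j) * ∑' k, B k ≤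
      ENNReal.ofReal (2 * P * ∑' k, geomWeight k) * E *
        ∑' j : ℤ, ENNReal.ofReal ((2:ℝ) ^ ((j:ℝ) * (1/2))) * B j := by
  set r : ℤ → ℝ≥0∞ := fun j => ENNReal.ofReal ((2:ℝ) ^ ((j:ℝ) * (1/2))) with hr
  set ρ : ℤ → ℝ≥0∞ := fun k => ENNReal.ofReal (geomWeight k) with hρ
  have hterm : ∀ j k, r j * A j * B k ≤
      ENNReal.ofReal P * E * (ρ (k - j) * (r k * B k) + ρ (k - j) * (r j * B j)) := by
    intro j k
    rcases le_or_gt j k with h | h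
    · have h' : (j:ℝ) ≤ k := by exact_mod_cast h
      have e : r j = ρ (k - j) * r k := by
        simp only [hr, hρ, geomWeight]
        rw [← ENNReal.ofReal_mul (by positivity), ← Real.rpow_add two_pos]
        congr 2
        push_cast
        rw [abs_of_nonneg (by linarith)]
        ring
      calc r j * A j * B k ≤ r j * (ENNReal.ofReal P * E) * B k := by gcongr; exact hA j
        _ = ENNReal.ofReal P * E * (ρ (k - j) * (r k * B k)) := by rw [e]; ring
        _ ≤ _ := by gcongr; exact le_self_add
    · have h' : (k:ℝ) < j := by exact_mod_cast h
      have e : ENNReal.ofReal ((2:ℝ)^k) ≤ ρ (k - j) * ENNReal.ofReal ((2:ℝ)^j) := by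
        simp only [hρ, geomWeight]
        rw [← ENNReal.ofReal_mul (by positivity), ← Real.rpow_intCast, ← Real.rpow_intCast,
          ← Real.rpow_add two_pos]
        refine ENNReal.ofReal_le_ofReal (Real.rpow_le_rpow_of_exponent_le one_le_two ?_)
        push_cast
        rw [abs_of_nonpos (by linarith)]
        linarith
      calc r j * A j * B k
          ≤ r j * A j * (ENNReal.ofReal P * (ρ (k - j) * ENNReal.ofReal ((2:ℝ)^j)) * E) := by
            gcongr
            exact (hB k).trans (by gcongr)
        _ = ENNReal.ofReal P * E * (ρ (k - j) * (r j * (ENNReal.ofReal ((2:ℝ)^j) * A j))) := by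
            ring
        _ ≤ ENNReal.ofReal P * E * (ρ (k - j) * (r j * B j)) := by gcongr; exact hAB j
        _ ≤ _ := by gcongr; exact le_add_self
  calc (∑' j, r j * A j) * ∑' k, B k = ∑' j, ∑' k, r j * A j * B k := by
        simp only [ENNReal.tsum_mul_left, ENNReal.tsum_mul_right]
    _ ≤ ∑' j, ∑' k, ENNReal.ofReal P * E *
          (ρ (k - j) * (r k * B k) + ρ (k - j) * (r j * B j)) :=
        ENNReal.tsum_le_tsum fun j => ENNReal.tsum_le_tsum fun k => hterm j k
    _ = ENNReal.ofReal P * E * (∑' k, ∑' j, ρ (k - j) * (r k * B k) +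
          ∑' j, ∑' k, ρ (k - j) * (r j * B j)) := by
        simp only [ENNReal.tsum_mul_left, ENNReal.tsum_add]
        rw [ENNReal.tsum_comm]
    _ = _ := by
        simp only [ENNReal.tsum_mul_right, hρ, tsum_ofReal_geomWeight_sub_left,
          tsum_ofReal_geomWeight_sub_right]
        simp only [ENNReal.tsum_mul_left]
        rw [ENNReal.ofReal_mul (by positivity), ENNReal.ofReal_mul (by positivity),
          ENNReal.ofReal_ofNat]
        ring

theorem IsLP.besov_one_eq {φ : ℝ → ℝ} (hφ : IsLP φ) (w : 𝓢(ℝ, ℂ)) (s : ℝ) :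
    besov φ s 2 1 w = ∑' j : ℤ, ENNReal.ofReal ((2:ℝ) ^ ((j:ℝ) * s)) * freqBlk φ w j := by
  rw [besov, lpSeq, eLpNorm_one_eq_lintegral_enorm, lintegral_count]
  refine tsum_congr fun j => ?_
  obtain ⟨h1, h2⟩ := hφ.eLpNorm_blk w j
  rw [h1, enorm_mul, Real.enorm_eq_ofReal (by positivity),
    Real.enorm_eq_ofReal ENNReal.toReal_nonneg, ENNReal.ofReal_toReal h2]

theorem besov_one_le {φ : ℝ → ℝ} (f : ℝ → ℂ) (s : ℝ) (p : ℝ≥0∞) :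
    besov φ s p 1 f ≤
      ∑' q : ℤ, ENNReal.ofReal ((2:ℝ) ^ ((q:ℝ) * s)) * eLpNorm (blk φ q f) p volume := by
  rw [besov, lpSeq, eLpNorm_one_eq_lintegral_enorm, lintegral_count]
  refine ENNReal.tsum_le_tsum fun q => ?_
  rw [enorm_mul, Real.enorm_eq_ofReal (by positivity),
    Real.enorm_eq_ofReal ENNReal.toReal_nonneg]
  gcongr
  exact ENNReal.ofReal_toReal_le

theorem IsLP.eLpNorm_le_tsum_freqBlk {φ : ℝ → ℝ} (hφ : IsLP φ) (w : 𝓢(ℝ, ℂ)) :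
    eLpNorm w 2 volume ≤ ∑' j, freqBlk φ w j := by
  rw [← eLpNorm_fourier_schwartz]
  refine hφ.eLpNorm_le_tsum ?_
  rw [← SchwartzMap.fourier_coe]
  exact (𝓕 w).continuous.aestronglyMeasurable

/-- For smooth `g` with `g(0) = g'(0) = 0` and `z` with
`‖z‖_∞ ≤ M`: `‖g(z)‖_{Ḃ^{3/2}_{1,1}(ℝ)} ≲_M ‖z‖_{L²} ‖z_x‖_{Ḃ^{1/2}_{2,1}}`. -/
theorem stmt10 (φ : ℝ → ℝ) (hφ : IsLP φ) (g : ℝ → ℝ) (hg : ContDiff ℝ (⊤ : ℕ∞) g)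
    (hg0 : g 0 = 0) (hg0' : deriv g 0 = 0) :
    ∀ M > (0:ℝ), ∃ C > (0:ℝ), ∀ z : 𝓢(ℝ, ℝ),
      eLpNorm (⇑z) ∞ (volume : Measure ℝ) ≤ ENNReal.ofReal M →
      besov φ (3/2) 1 1 (fun x => ((g (z x) : ℝ) : ℂ))
        ≤ ENNReal.ofReal C * eLpNorm (⇑z) 2 (volume : Measure ℝ) *
            besov φ (1/2) 2 1 (fun x => ((deriv (⇑z) x : ℝ) : ℂ)) := by
  intro M hM
  obtain ⟨L, hL, hlip, hlin, hgM⟩ := exists_lipschitz_bound hg hg0 hg0' hM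
  obtain ⟨m, hm0, hm⟩ := hφ.exists_symbol
  obtain ⟨Cl, hCl, hker⟩ := exists_lintegral_dilate_mul_min_le (𝓕⁻ m)
  obtain ⟨P, hP, hbd⟩ := hφ.exists_freqBlk_le
  set S := ∑' k, geomWeight k with hS
  have hS0 : 0 ≤ S := tsum_nonneg fun k => (geomWeight_pos k).le
  refine ⟨L * 20 * (Cl * S) * (1 + 2 * P * S) + 1, by positivity, fun z hzM => ?_⟩
  have hz := abs_le_of_eLpNorm_top_le z hM hzM
  have hW : (fun x => ((deriv (⇑z) x : ℝ) : ℂ)) =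
      SchwartzMap.derivCLM ℂ ℂ (complexify z) :=
    funext fun x => (derivCLM_complexify_apply z x).symm
  have hE : eLpNorm z 2 (volume : Measure ℝ) = eLpNorm (complexify z) 2 volume :=
    eLpNorm_congr_norm_ae (Filter.Eventually.of_forall fun x => by simp [complexify_apply])
  rw [hW, hφ.besov_one_eq, hE]
  set Z := complexify z with hZ
  set W := SchwartzMap.derivCLM ℂ ℂ Z with hWdef
  set E := eLpNorm Z 2 volume with hEdef
  set T := ∑' j : ℤ, ENNReal.ofReal ((2:ℝ) ^ ((j:ℝ) * (1/2))) * freqBlk φ W j with hT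
  set f : ℝ → ℂ := fun x => ((g (z x) : ℝ) : ℂ) with hf
  set D : ℤ → ℝ≥0∞ := fun j => ENNReal.ofReal (L * 20) *
    (E * freqBlk φ W j + freqBlk φ Z j * eLpNorm W 2 volume) with hD
  have hdiff : ∀ y, eLpNorm (fun x => deriv f (x - y) - deriv f x) 1 volume ≤
      ∑' j : ℤ, ENNReal.ofReal (min 1 (|y| * (2:ℝ)^j)) * D j := by
    intro y
    refine (eLpNorm_deriv_comp_translate_le hg hL hlip hlin z hz y).trans ?_
    calc _ ≤ ENNReal.ofReal L * (E *
          (∑' j : ℤ, ENNReal.ofReal (20 * min 1 (|y| * (2:ℝ)^j)) * freqBlk φ W j) +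
          (∑' j : ℤ, ENNReal.ofReal (20 * min 1 (|y| * (2:ℝ)^j)) * freqBlk φ Z j) *
            eLpNorm W 2 volume) := by
          gcongr
          · exact hφ.eLpNorm_translate_sub_le W y
          · exact hφ.eLpNorm_translate_sub_le Z y
      _ = _ := by
          rw [← ENNReal.tsum_mul_left, ← ENNReal.tsum_mul_right, ← ENNReal.tsum_add,
            ← ENNReal.tsum_mul_left]
          refine tsum_congr fun j => ?_
          rw [hD, ENNReal.ofReal_mul (by norm_num), ENNReal.ofReal_mul hL]
          ring
  have hblk : ∀ q : ℤ, eLpNorm (blk φ q f) 1 volume ≤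
      ∑' j : ℤ, (∫⁻ y : ℝ, ‖(𝓕⁻ m) ((2:ℝ)^q * y)‖ₑ *
        ENNReal.ofReal (min 1 (|y| * (2:ℝ)^j))) * D j := by
    intro q
    refine (eLpNorm_blk_one_le hm0 hm (integrable_comp_schwartz hg hgM z hz)
      (contDiff_comp_schwartz hg z) (integrable_deriv_comp_schwartz hg hL hlin z hz) q).trans ?_
    have hk : Continuous ((𝓕⁻ m : 𝓢(ℝ, ℂ)) : ℝ → ℂ) := (𝓕⁻ m).continuous
    have hmeas : ∀ j : ℤ, Measurable fun y : ℝ => ‖(𝓕⁻ m) ((2:ℝ)^q * y)‖ₑ *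
        ENNReal.ofReal (min 1 (|y| * (2:ℝ)^j)) := by
      intro j
      have h1 : Continuous fun y : ℝ => ‖(𝓕⁻ m) ((2:ℝ)^q * y)‖ₑ := by fun_prop
      have h2 : Continuous fun y : ℝ => ENNReal.ofReal (min 1 (|y| * (2:ℝ)^j)) :=
        ENNReal.continuous_ofReal.comp (by fun_prop)
      exact h1.measurable.mul h2.measurable
    calc _ ≤ ∫⁻ y : ℝ, ∑' j : ℤ, ‖(𝓕⁻ m) ((2:ℝ)^q * y)‖ₑ *
          ENNReal.ofReal (min 1 (|y| * (2:ℝ)^j)) * D j := by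
          refine lintegral_mono fun y => ?_
          simp only [mul_assoc, ENNReal.tsum_mul_left]
          gcongr
          exact hdiff y
      _ = _ := by
          rw [lintegral_tsum fun j => ((hmeas j).mul_const _).aemeasurable]
          exact tsum_congr fun j => lintegral_mul_const _ (hmeas j)
  have hmain : besov φ (3/2) 1 1 f ≤ ∑' j : ℤ, ENNReal.ofReal (Cl * S) *
      ENNReal.ofReal ((2:ℝ) ^ ((j:ℝ) * (1/2))) * D j := by
    refine (besov_one_le f _ _).trans ?_
    calc _ ≤ ∑' q : ℤ, ∑' j : ℤ, ENNReal.ofReal ((2:ℝ) ^ ((q:ℝ) * (3/2))) *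
          (∫⁻ y : ℝ, ‖(𝓕⁻ m) ((2:ℝ)^q * y)‖ₑ *
            ENNReal.ofReal (min 1 (|y| * (2:ℝ)^j))) * D j := by
          refine ENNReal.tsum_le_tsum fun q => ?_
          simp only [mul_assoc, ENNReal.tsum_mul_left]
          gcongr
          exact hblk q
      _ ≤ _ := by
          rw [ENNReal.tsum_comm]
          refine ENNReal.tsum_le_tsum fun j => ?_
          rw [ENNReal.tsum_mul_right]
          gcongr
          exact tsum_lintegral_dilate_le hCl hker j
  have hprod := tsum_mul_tsum_le hP (fun j => (hbd Z j).1) (fun j => (hbd Z j).2)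
    (fun j => hφ.zpow_mul_freqBlk_le Z j)
  calc besov φ (3/2) 1 1 f
      ≤ ∑' j : ℤ, ENNReal.ofReal (Cl * S) * ENNReal.ofReal ((2:ℝ) ^ ((j:ℝ) * (1/2))) * D j := hmain
    _ = ENNReal.ofReal (Cl * S) * ENNReal.ofReal (L * 20) * (E * T +
          (∑' j : ℤ, ENNReal.ofReal ((2:ℝ) ^ ((j:ℝ) * (1/2))) * freqBlk φ Z j) *
            eLpNorm W 2 volume) := by
        rw [hT, ← ENNReal.tsum_mul_left, ← ENNReal.tsum_mul_right, ← ENNReal.tsum_add,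
          ← ENNReal.tsum_mul_left]
        refine tsum_congr fun j => ?_
        rw [hD]
        ring
    _ ≤ ENNReal.ofReal (Cl * S) * ENNReal.ofReal (L * 20) * (E * T +
          ENNReal.ofReal (2 * P * S) * E * T) := by
        gcongr _ * (_ + ?_)
        refine le_trans ?_ hprod
        gcongr
        exact hφ.eLpNorm_le_tsum_freqBlk W
    _ = ENNReal.ofReal (L * 20 * (Cl * S) * (1 + 2 * P * S)) * E * T := by
        rw [ENNReal.ofReal_mul (p := L * 20 * (Cl * S)) (by positivity),
          ENNReal.ofReal_mul (p := L * 20) (by positivity),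
          ENNReal.ofReal_add (by norm_num) (by positivity), ENNReal.ofReal_one]
        ring
    _ ≤ _ := by
        gcongr
        linarith
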